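/- For 0 < d < 1/2 and σ_ε² > 0, let σ(m) = σ_ε² Γ(1−2d) Γ(|m|+d)/(Γ(d) Γ(1−d) Γ(|m|+1−d)) for m ∈ ℤ, and a_0 = 1, a_j = Γ(j−d)/(Γ(j+1)Γ(−d)) for j ≥ 1. For k ≥ 1 let Σ_k be the k×k symmetric Toeplitz matrix with entries (Σ_k)_{i,j} = σ(i−j), assumed positive definite, and let v_k = (σ(1), …, σ(k))ᵀ. Then the k-th order best linear one-step prediction error satisfies σ_ε² ≤ σ(0) − v_kᵀ Σ_k^{−1} v_k ≤ σ_ε² + Σ_{j=k+1}^∞ Σ_{l=k+1}^∞ a_j a_l σ(l−j); consequently σ(0) − v_kᵀ Σ_k^{−1} v_k − σ_ε² = O(k^{−1}) as k → ∞. -/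

import Mathlib

open Filter Real Asymptotics Matrix

/-- The normalised weights `Γ(n+1-d) / (Γ(n+1) Γ(1-d)) = ∏_{i=1}^n (i-d)/i`, which are also the
partial sums of the AR coefficients of `F(d)`. -/
noncomputable def fracWeight (d : ℝ) : ℕ → ℝ
  | 0 => 1
  | n + 1 => fracWeight d n * ((n + 1 - d) / (n + 1))

lemma fracWeight_succ_mul (d : ℝ) (n : ℕ) :
    fracWeight d (n + 1) * (n + 1) = fracWeight d n * (n + 1 - d) := by
  have : (n : ℝ) + 1 ≠ 0 := by positivity
  rw [fracWeight]
  field_simp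

lemma fracWeight_pos {d : ℝ} (hd1 : d < 1) (n : ℕ) : 0 < fracWeight d n := by
  induction n with
  | zero => simp [fracWeight]
  | succ n ih =>
    have hn : (0 : ℝ) ≤ n := n.cast_nonneg
    rw [fracWeight]
    exact mul_pos ih (div_pos (by linarith) (by linarith))

lemma fracWeight_le_one {d : ℝ} (hd0 : 0 < d) (hd1 : d < 1) (n : ℕ) : fracWeight d n ≤ 1 := by
  induction n with
  | zero => simp [fracWeight]
  | succ n ih =>
    have hn : (0 : ℝ) ≤ n := n.cast_nonneg
    rw [fracWeight]
    refine mul_le_one₀ ih (div_nonneg (by linarith) (by linarith)) ?_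
    rw [div_le_one (by linarith)]
    linarith

lemma fracWeight_mul_le {d : ℝ} (hd0 : 0 < d) (hd1 : d < 1) (n l : ℕ) :
    fracWeight d n * fracWeight d l ≤ fracWeight d (n + l) := by
  induction l with
  | zero => simp [fracWeight]
  | succ l ih =>
    have hn : (0 : ℝ) ≤ n := n.cast_nonneg
    have hl : (0 : ℝ) ≤ l := l.cast_nonneg
    rw [← add_assoc, fracWeight, fracWeight, ← mul_assoc]
    refine mul_le_mul ih ?_ (div_nonneg (by linarith) (by linarith)) (fracWeight_pos hd1 _).le
    push_cast
    rw [div_le_div_iff₀ (by linarith) (by linarith)]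
    nlinarith

lemma fracWeight_eq_Gamma {d : ℝ} (hd1 : d < 1) (n : ℕ) :
    fracWeight d n = Gamma (n + 1 - d) / (Gamma (n + 1) * Gamma (1 - d)) := by
  have h1 : Gamma (1 - d) ≠ 0 := (Gamma_pos_of_pos (by linarith)).ne'
  induction n with
  | zero => simp [fracWeight, h1]
  | succ n ih =>
    have hn : (0 : ℝ) ≤ n := n.cast_nonneg
    have e1 : Gamma ((n + 1 : ℕ) + 1 - d) = (n + 1 - d) * Gamma (n + 1 - d) := by
      rw [← Gamma_add_one (by linarith)]
      congr 1
      push_cast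
      ring
    have e2 : Gamma ((n + 1 : ℕ) + 1) = (n + 1) * Gamma (n + 1) := by
      rw [← Gamma_add_one (by linarith)]
      push_cast
      rfl
    have h2 : Gamma ((n : ℝ) + 1) ≠ 0 := (Gamma_pos_of_pos (by linarith)).ne'
    rw [fracWeight, ih, e1, e2]
    field_simp

lemma tendsto_fracWeight_div {d : ℝ} (hd1 : d < 1) (l : ℕ) :
    Tendsto (fun n : ℕ => fracWeight d n / fracWeight d (n + l)) atTop (nhds 1) := by
  induction l with
  | zero =>
    refine tendsto_const_nhds.congr fun n => ?_
    rw [add_zero, div_self (fracWeight_pos hd1 n).ne']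
  | succ l ih =>
    have h : Tendsto (fun n : ℕ => 1 - d * ((n + l : ℕ) + 1 : ℝ)⁻¹) atTop (nhds 1) := by
      have := (((tendsto_one_div_add_atTop_nhds_zero_nat (𝕜 := ℝ)).comp
        (tendsto_add_atTop_nat l)).const_mul d).const_sub 1
      simpa [Function.comp_def] using this
    have h2 := ih.div h one_ne_zero
    rw [div_one] at h2
    refine h2.congr fun n => ?_
    have hn : (0 : ℝ) ≤ (n + l : ℕ) := Nat.cast_nonneg _
    have hg := (fracWeight_pos hd1 (n + l)).ne'
    have hp : ((n + l : ℕ) : ℝ) + 1 ≠ 0 := by linarith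
    have hq : ((n + l : ℕ) : ℝ) + 1 - d ≠ 0 := by linarith
    simp only [Pi.div_apply]
    rw [← add_assoc n l 1, fracWeight]
    have : 1 - d * (((n + l : ℕ) : ℝ) + 1)⁻¹
        = (((n + l : ℕ) : ℝ) + 1 - d) / (((n + l : ℕ) : ℝ) + 1) := by
      field_simp
    rw [this, div_div]

section Recurrences

variable {d : ℝ} {a : ℕ → ℝ} {σ : ℤ → ℝ}

lemma intCast_add_ne_zero (hd0 : 0 < d) (hd1 : d < 1) (m : ℤ) : (m : ℝ) + d ≠ 0 := by
  intro h
  rcases lt_or_ge m 0 with hm | hm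
  · have : (m : ℝ) ≤ -1 := by exact_mod_cast Int.le_sub_one_of_lt hm
    linarith
  · have : (0 : ℝ) ≤ m := by exact_mod_cast hm
    linarith

lemma natCast_sub_ne_zero (hd0 : 0 < d) (hd1 : d < 1) (l : ℕ) : (l : ℝ) - d ≠ 0 := by
  intro h
  refine intCast_add_ne_zero hd0 hd1 (-l) ?_
  push_cast
  linarith

lemma coeff_mul_sub (ha0 : a 0 = 1) (ha : ∀ l : ℕ, a (l + 1) * (l + 1) = a l * (l - d))
    (l : ℕ) : a l * (l - d) = -d * fracWeight d l := by
  induction l with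
  | zero => simp [ha0, fracWeight]
  | succ l ih =>
    have hl : (l : ℝ) + 1 ≠ 0 := by positivity
    rw [← ha] at ih
    refine mul_right_cancel₀ hl ?_
    have := fracWeight_succ_mul d l
    push_cast
    linear_combination (l + 1 - d) * ih + d * this

/-- The contiguity relation, in the lag, for the sums `∑ a_l g(k-l) σ(l-j)`. -/
lemma sum_lag_recurrence (ha : ∀ l : ℕ, a (l + 1) * (l + 1) = a l * (l - d))
    (hσ : ∀ m : ℤ, σ (m + 1) * (m + 1 - d) = σ m * (m + d))
    (hd0 : 0 < d) (hd1 : d < 1) (k j : ℕ) :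
    (j + 1 - d) * (k - j) *
        ∑ l ∈ Finset.range (k + 1), a l * fracWeight d (k - l) * σ (l - (j + 1 : ℕ)) =
      j * (k - j - d) *
        ∑ l ∈ Finset.range (k + 1), a l * fracWeight d (k - l) * σ (l - j) := by
  set f : ℕ → ℕ → ℝ := fun i l => a l * fracWeight d (k - l) * σ (l - i) with hf
  have key : ∀ l : ℕ, -((j + 1 - d) * (k - j)) * f (j + 1) l + j * (k - j - d) * f j l =
      (k - l) * (l - d) * f j l - l * (k - l + 1 - d) * f (j + 1) l := by
    intro l
    have hne : (l : ℝ) - j - 1 + d ≠ 0 := by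
      have := intCast_add_ne_zero hd0 hd1 (l - j - 1)
      push_cast at this
      exact this
    have h := hσ (l - (j + 1 : ℕ))
    rw [show (l : ℤ) - (j + 1 : ℕ) + 1 = l - j by push_cast; ring] at h
    push_cast at h
    refine mul_right_cancel₀ hne ?_
    simp only [hf]
    push_cast
    linear_combination (-((l : ℝ) * (k - l + 1 - d)) + (j + 1 - d) * (k - j)) *
      (a l * fracWeight d (k - l)) * h
  have shift : ∑ l ∈ Finset.range (k + 1), ((k : ℝ) - l) * (l - d) * f j l =
      ∑ l ∈ Finset.range (k + 1), (l : ℝ) * (k - l + 1 - d) * f (j + 1) l := by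
    rw [Finset.sum_range_succ, Finset.sum_range_succ']
    simp only [sub_self, zero_mul, add_zero, Nat.cast_zero]
    refine Finset.sum_congr rfl fun l hl => ?_
    obtain ⟨n, rfl⟩ := Nat.exists_eq_add_of_lt (Finset.mem_range.1 hl)
    have h1 := ha l
    have h2 := fracWeight_succ_mul d n
    simp only [hf]
    rw [show l + n + 1 - l = n + 1 by omega, show l + n + 1 - (l + 1) = n by omega,
      show ((l + 1 : ℕ) : ℤ) - (j + 1 : ℕ) = l - j by push_cast; ring]
    push_cast
    linear_combination (l - d) * a l * σ (l - j) * h2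
      - (n + 1 - d) * fracWeight d n * σ (l - j) * h1
  have total := Finset.sum_congr (rfl : Finset.range (k + 1) = _) fun l _ => key l
  rw [Finset.sum_sub_distrib, shift, sub_self, Finset.sum_add_distrib, ← Finset.mul_sum,
    ← Finset.mul_sum] at total
  linarith

/-- The weights `a_l g(k-l)` satisfy the homogeneous Yule–Walker equations of order `k`. -/
lemma sum_lag_eq_zero (ha : ∀ l : ℕ, a (l + 1) * (l + 1) = a l * (l - d))
    (hσ : ∀ m : ℤ, σ (m + 1) * (m + 1 - d) = σ m * (m + d))
    (hd0 : 0 < d) (hd1 : d < 1) (k j : ℕ) (hj : j < k) :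
    ∑ l ∈ Finset.range (k + 1), a l * fracWeight d (k - l) * σ (l - (j + 1 : ℕ)) = 0 := by
  have hstep : ∀ i : ℕ, i < k →
      (i : ℝ) * ∑ l ∈ Finset.range (k + 1), a l * fracWeight d (k - l) * σ (l - i) = 0 →
      ∑ l ∈ Finset.range (k + 1), a l * fracWeight d (k - l) * σ (l - (i + 1 : ℕ)) = 0 := by
    intro i hi h
    have hik : (i : ℝ) < k := by exact_mod_cast hi
    have hi0 : (0 : ℝ) ≤ i := i.cast_nonneg
    have hne : ((i : ℝ) + 1 - d) * (k - i) ≠ 0 := mul_ne_zero (by linarith) (by linarith)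
    refine (mul_eq_zero.1 ((sum_lag_recurrence ha hσ hd0 hd1 k i).trans ?_)).resolve_left hne
    linear_combination (k - i - d) * h
  induction j with
  | zero => exact hstep 0 hj (by simp)
  | succ j ih => exact hstep (j + 1) hj (by rw [ih (by omega), mul_zero])

lemma sum_zero_lag_recurrence (ha : ∀ l : ℕ, a (l + 1) * (l + 1) = a l * (l - d))
    (hσ : ∀ m : ℤ, σ (m + 1) * (m + 1 - d) = σ m * (m + d)) (k : ℕ) :
    (k + 1 - d) * ∑ l ∈ Finset.range (k + 1 + 1), a l * fracWeight d (k + 1 - l) * σ l =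
      (k + 1 - 2 * d) * ∑ l ∈ Finset.range (k + 1), a l * fracWeight d (k - l) * σ l := by
  set y : ℕ → ℝ := fun l => a l * fracWeight d (k + 1 - l) * σ l with hy
  set x : ℕ → ℝ := fun l => a l * fracWeight d (k - l) * σ l with hx
  have key : ∀ l ∈ Finset.range (k + 1),
      (k + 1) * (k + 1 - 2 * d) * x l - (k + 1) * (k + 1 - d) * y l =
        (l ^ 2 - d ^ 2) * x l - l * (l - d) * y l := by
    intro l hl
    obtain ⟨n, rfl⟩ := Nat.exists_eq_add_of_le (Nat.lt_succ_iff.1 (Finset.mem_range.1 hl))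
    have h := fracWeight_succ_mul d n
    have hn : (n : ℝ) + 1 ≠ 0 := by positivity
    refine mul_right_cancel₀ hn ?_
    simp only [hx, hy]
    rw [show l + n + 1 - l = n + 1 by omega, show l + n - l = n by omega]
    push_cast
    linear_combination (l * (l - d) - (l + n + 1) * (l + n + 1 - d)) * a l * σ l * h
  have shift : ∑ l ∈ Finset.range (k + 1), ((l : ℝ) ^ 2 - d ^ 2) * x l =
      ∑ l ∈ Finset.range (k + 1 + 1), (l : ℝ) * (l - d) * y l := by
    rw [Finset.sum_range_succ' _ (k + 1)]
    simp only [Nat.cast_zero, zero_mul, add_zero]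
    refine Finset.sum_congr rfl fun l hl => ?_
    have h1 := ha l
    have h2 := hσ l
    simp only [hx, hy]
    rw [show k + 1 - (l + 1) = k - l by omega]
    push_cast at h2 ⊢
    linear_combination -(l - d) * a l * fracWeight d (k - l) * h2
      - (l + 1 - d) * fracWeight d (k - l) * σ (l + 1) * h1
  have total := Finset.sum_congr rfl key
  rw [Finset.sum_sub_distrib, Finset.sum_sub_distrib, shift, Finset.sum_range_succ _ (k + 1),
    ← Finset.mul_sum, ← Finset.mul_sum] at total
  have hk : (k : ℝ) + 1 ≠ 0 := by positivity
  rw [Finset.sum_range_succ y (k + 1)]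
  refine mul_left_cancel₀ hk ?_
  push_cast at total
  linear_combination -total

lemma sum_zero_lag_eq_Gamma {σε2 : ℝ} (ha0 : a 0 = 1)
    (ha : ∀ l : ℕ, a (l + 1) * (l + 1) = a l * (l - d))
    (hσ : ∀ m : ℤ, σ (m + 1) * (m + 1 - d) = σ m * (m + d))
    (hσ0 : σ 0 = σε2 * Gamma (1 - 2 * d) / Gamma (1 - d) ^ 2)
    (hd0 : 0 < d) (hd2 : d < 1 / 2) (k : ℕ) :
    ∑ l ∈ Finset.range (k + 1), a l * fracWeight d (k - l) * σ l =
      σε2 * Gamma (k + 1 - 2 * d) / (Gamma (k + 1 - d) * Gamma (1 - d)) := by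
  induction k with
  | zero => simp [fracWeight, ha0, hσ0, sq]
  | succ k ih =>
    have hk : (0 : ℝ) ≤ k := k.cast_nonneg
    have h := sum_zero_lag_recurrence ha hσ k
    have e1 : Gamma ((k + 1 : ℕ) + 1 - d) = (k + 1 - d) * Gamma (k + 1 - d) := by
      rw [← Gamma_add_one (by linarith)]
      congr 1
      push_cast
      ring
    have e2 : Gamma ((k + 1 : ℕ) + 1 - 2 * d) = (k + 1 - 2 * d) * Gamma (k + 1 - 2 * d) := by
      rw [← Gamma_add_one (by linarith)]
      congr 1
      push_cast
      ring
    have hne : (k : ℝ) + 1 - d ≠ 0 := by linarith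
    have h1 : Gamma (1 - d) ≠ 0 := (Gamma_pos_of_pos (by linarith)).ne'
    have h2 : Gamma ((k : ℝ) + 1 - d) ≠ 0 := (Gamma_pos_of_pos (by linarith)).ne'
    refine mul_left_cancel₀ hne ?_
    rw [h, ih, e1, e2]
    field_simp

end Recurrences

/-- The coefficients of the prediction error filter of order `k` of `F(d)`. -/
noncomputable def predFilter (d : ℝ) (a : ℕ → ℝ) (k l : ℕ) : ℝ :=
  a l * (fracWeight d (k - l) / fracWeight d k)

/-- The one-step prediction error of order `k` of `F(d)` with unit innovation variance. -/
noncomputable def predError (d : ℝ) (k : ℕ) : ℝ :=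
  Gamma (k + 1) * Gamma (k + 1 - 2 * d) / Gamma (k + 1 - d) ^ 2

lemma one_le_predError {d : ℝ} (hd2 : d < 1 / 2) (k : ℕ) :
    1 ≤ predError d k := by
  have hk : (0 : ℝ) ≤ k := k.cast_nonneg
  have h1 : 0 < Gamma ((k : ℝ) + 1) := Gamma_pos_of_pos (by linarith)
  have h2 : 0 < Gamma ((k : ℝ) + 1 - 2 * d) := Gamma_pos_of_pos (by linarith)
  have h := Gamma_mul_add_mul_le_rpow_Gamma_mul_rpow_Gamma (s := (k : ℝ) + 1)
    (t := (k : ℝ) + 1 - 2 * d) (a := 1 / 2) (b := 1 / 2) (by linarith) (by linarith)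
    (by norm_num) (by norm_num) (by norm_num)
  rw [show 1 / 2 * ((k : ℝ) + 1) + 1 / 2 * ((k : ℝ) + 1 - 2 * d) = k + 1 - d by ring] at h
  have h3 : 0 < Gamma ((k : ℝ) + 1 - d) := Gamma_pos_of_pos (by linarith)
  rw [predError, le_div_iff₀ (by positivity), one_mul]
  calc Gamma ((k : ℝ) + 1 - d) ^ 2
      ≤ (Gamma ((k : ℝ) + 1) ^ (1 / 2 : ℝ) * Gamma ((k : ℝ) + 1 - 2 * d) ^ (1 / 2 : ℝ)) ^ 2 := by
        gcongr
    _ = _ := by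
        rw [mul_pow, ← sqrt_eq_rpow, ← sqrt_eq_rpow, sq_sqrt h1.le, sq_sqrt h2.le]

lemma Gamma_add_le {x s : ℝ} (hx : 0 < x) (hs0 : 0 < s) (hs1 : s < 1) :
    Gamma (x + s) ≤ Gamma x * x ^ s := by
  have hg : 0 < Gamma x := Gamma_pos_of_pos hx
  have h := Gamma_mul_add_mul_le_rpow_Gamma_mul_rpow_Gamma (s := x) (t := x + 1)
    (a := 1 - s) (b := s) hx (by linarith) (by linarith) hs0 (by ring)
  rw [show (1 - s) * x + s * (x + 1) = x + s by ring, Gamma_add_one hx.ne',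
    mul_rpow hx.le hg.le, mul_left_comm, ← rpow_add hg, sub_add_cancel, rpow_one] at h
  linarith

lemma predError_le {d : ℝ} (hd0 : 0 < d) (hd2 : d < 1 / 2) {k : ℕ} (hk : 1 ≤ k) :
    predError d k ≤ 1 + d / (k - d) := by
  have hk' : (1 : ℝ) ≤ k := by exact_mod_cast hk
  have hx : 0 < (k : ℝ) - d := by linarith
  have hgx : 0 < Gamma ((k : ℝ) - d) := Gamma_pos_of_pos hx
  have e : Gamma ((k : ℝ) + 1 - d) = (k - d) * Gamma (k - d) := by
    rw [← Gamma_add_one hx.ne']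
    congr 1
    ring
  have h1 : Gamma ((k : ℝ) + 1) ≤ Gamma (k + 1 - d) * (k + 1 - d) ^ d := by
    have := Gamma_add_le (x := (k : ℝ) + 1 - d) (by linarith) hd0 (by linarith)
    rwa [sub_add_cancel] at this
  have h2 : Gamma ((k : ℝ) + 1 - 2 * d) ≤ Gamma (k + 1 - d) * ((k : ℝ) - d) ^ (-d) := by
    have := Gamma_add_le (x := (k : ℝ) - d) (s := 1 - d) hx (by linarith) (by linarith)
    rw [show (k : ℝ) - d + (1 - d) = k + 1 - 2 * d by ring, sub_eq_add_neg 1 d, rpow_add hx,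
      rpow_one] at this
    rw [e]
    linarith
  have h3 : 0 < Gamma ((k : ℝ) + 1 - d) := Gamma_pos_of_pos (by linarith)
  have h4 : 0 < Gamma ((k : ℝ) + 1 - 2 * d) := Gamma_pos_of_pos (by linarith)
  calc predError d k
      ≤ (Gamma (k + 1 - d) * (k + 1 - d) ^ d) * (Gamma (k + 1 - d) * ((k : ℝ) - d) ^ (-d)) /
          Gamma (k + 1 - d) ^ 2 := by
        rw [predError]
        have : 0 ≤ (k : ℝ) + 1 - d := by linarith
        gcongr
    _ = (1 + 1 / ((k : ℝ) - d)) ^ d := by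
        rw [rpow_neg hx.le, show 1 + 1 / ((k : ℝ) - d) = (k + 1 - d) / (k - d) by
          field_simp; ring, div_rpow (by linarith) hx.le]
        field_simp
    _ ≤ 1 + d * (1 / ((k : ℝ) - d)) := by
        refine rpow_one_add_le_one_add_mul_self ?_ hd0.le (by linarith)
        have := one_div_pos.2 hx
        linarith
    _ = 1 + d / (k - d) := by rw [mul_one_div]

lemma tendsto_predError {d : ℝ} (hd0 : 0 < d) (hd2 : d < 1 / 2) :
    Tendsto (predError d) atTop (nhds 1) := by
  have hup : Tendsto (fun k : ℕ => 1 + d / ((k : ℝ) - d)) atTop (nhds 1) := by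
    have h : Tendsto (fun k : ℕ => (k : ℝ) - d) atTop atTop :=
      tendsto_atTop_add_const_right _ _ tendsto_natCast_atTop_atTop
    simpa using (h.const_div_atTop d).const_add 1
  refine tendsto_of_tendsto_of_tendsto_of_le_of_le' tendsto_const_nhds hup
    (Eventually.of_forall fun k => one_le_predError hd2 k) ?_
  filter_upwards [eventually_ge_atTop 1] with k hk using predError_le hd0 hd2 hk

section Prediction

variable {d σε2 : ℝ} {a : ℕ → ℝ} {σ : ℤ → ℝ}

lemma predFilter_zero (ha0 : a 0 = 1) (hd1 : d < 1) (k : ℕ) : predFilter d a k 0 = 1 := by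
  rw [predFilter, ha0, one_mul, Nat.sub_zero, div_self (fracWeight_pos hd1 k).ne']

/-- The finite-order Yule–Walker equations, with their explicit solution. -/
lemma sum_predFilter (ha0 : a 0 = 1)
    (ha : ∀ l : ℕ, a (l + 1) * (l + 1) = a l * (l - d))
    (hσ : ∀ m : ℤ, σ (m + 1) * (m + 1 - d) = σ m * (m + d))
    (hσ0 : σ 0 = σε2 * Gamma (1 - 2 * d) / Gamma (1 - d) ^ 2)
    (hd0 : 0 < d) (hd2 : d < 1 / 2) (k j : ℕ) (hj : j ≤ k) :
    ∑ l ∈ Finset.range (k + 1), predFilter d a k l * σ (l - j) =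
      if j = 0 then σε2 * predError d k else 0 := by
  have hd1 : d < 1 := by linarith
  have hk : (0 : ℝ) ≤ k := k.cast_nonneg
  have e : ∑ l ∈ Finset.range (k + 1), predFilter d a k l * σ (l - j) =
      (∑ l ∈ Finset.range (k + 1), a l * fracWeight d (k - l) * σ (l - j)) /
        fracWeight d k := by
    rw [Finset.sum_div]
    refine Finset.sum_congr rfl fun l _ => ?_
    rw [predFilter]
    ring
  rw [e]
  rcases j with _ | j
  · simp only [Nat.cast_zero, sub_zero, if_true]
    rw [sum_zero_lag_eq_Gamma ha0 ha hσ hσ0 hd0 hd2, fracWeight_eq_Gamma hd1, predError]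
    have h1 : Gamma (1 - d) ≠ 0 := (Gamma_pos_of_pos (by linarith)).ne'
    have h2 : Gamma ((k : ℝ) + 1 - d) ≠ 0 := (Gamma_pos_of_pos (by linarith)).ne'
    have h3 : Gamma ((k : ℝ) + 1) ≠ 0 := (Gamma_pos_of_pos (by linarith)).ne'
    field_simp
  · rw [sum_lag_eq_zero ha hσ hd0 hd1 k j (by omega), zero_div, if_neg (by omega)]

lemma summable_autocov_div (hσ : ∀ m : ℤ, σ (m + 1) * (m + 1 - d) = σ m * (m + d))
    (hpos : ∀ m, 0 < σ m) (hd2 : d < 1 / 2) :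
    Summable fun n : ℕ => σ n / (n + 1 - d) := by
  have hterm : ∀ n : ℕ, σ n / (n + 1 - d) = (σ n - σ (n + 1 : ℕ)) / (1 - 2 * d) := by
    intro n
    have hn : (0 : ℝ) ≤ n := n.cast_nonneg
    have h := hσ n
    push_cast at h ⊢
    rw [div_eq_div_iff (by linarith) (by linarith)]
    linear_combination h
  refine summable_of_sum_range_le (c := σ 0 / (1 - 2 * d)) (fun n => ?_) fun n => ?_
  · have hn : (0 : ℝ) ≤ n := n.cast_nonneg
    exact div_nonneg (hpos _).le (by linarith)
  · simp only [hterm]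
    rw [← Finset.sum_div, Finset.sum_range_sub' (fun n : ℕ => σ n)]
    have := hpos n
    have h1 : 0 < 1 - 2 * d := by linarith
    gcongr
    simpa using this.le

lemma summable_autocov_shift_div (hσ : ∀ m : ℤ, σ (m + 1) * (m + 1 - d) = σ m * (m + d))
    (hpos : ∀ m, 0 < σ m) (hd2 : d < 1 / 2) (j : ℕ) :
    Summable fun l : ℕ => 2 / (l + 1 - d) * σ (l - j) := by
  rw [← summable_nat_add_iff j]
  refine Summable.of_nonneg_of_le (fun n => ?_) (fun n => ?_)
    ((summable_autocov_div hσ hpos hd2).mul_left 2)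
  · have hn : (0 : ℝ) ≤ (n + j : ℕ) := Nat.cast_nonneg _
    exact mul_nonneg (div_nonneg (by norm_num) (by linarith)) (hpos _).le
  · have hn : (0 : ℝ) ≤ n := n.cast_nonneg
    have hj : (0 : ℝ) ≤ j := j.cast_nonneg
    have := hpos n
    rw [show ((n + j : ℕ) : ℤ) - j = n by push_cast; ring, mul_div_assoc', div_mul_eq_mul_div]
    push_cast
    gcongr
    · linarith
    · linarith

lemma abs_coeff_le (ha0 : a 0 = 1) (ha : ∀ l : ℕ, a (l + 1) * (l + 1) = a l * (l - d))
    (hd0 : 0 < d) (hd2 : d < 1 / 2) (l : ℕ) :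
    |a l| ≤ 2 / (l + 1 - d) * fracWeight d l := by
  have hd1 : d < 1 := by linarith
  have hg := fracWeight_pos hd1 l
  have hl0 : (0 : ℝ) ≤ l := l.cast_nonneg
  have hne := natCast_sub_ne_zero hd0 hd1 l
  have h : |a l| = d * fracWeight d l / |(l : ℝ) - d| := by
    rw [eq_div_iff (abs_ne_zero.2 hne), ← abs_mul, coeff_mul_sub ha0 ha, neg_mul, abs_neg,
      abs_of_pos (mul_pos hd0 hg)]
  have hkey : d * (l + 1 - d) ≤ 2 * |(l : ℝ) - d| := by
    rcases l with _ | l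
    · simp only [Nat.cast_zero, zero_sub, abs_neg, abs_of_pos hd0]
      nlinarith
    · have hl : (0 : ℝ) ≤ l := l.cast_nonneg
      push_cast
      rw [abs_of_pos (by linarith)]
      nlinarith
  rw [h, div_mul_eq_mul_div, div_le_div_iff₀ (abs_pos.2 hne) (by linarith)]
  nlinarith

lemma summable_coeff_mul_autocov (ha0 : a 0 = 1)
    (ha : ∀ l : ℕ, a (l + 1) * (l + 1) = a l * (l - d))
    (hσ : ∀ m : ℤ, σ (m + 1) * (m + 1 - d) = σ m * (m + d))
    (hpos : ∀ m, 0 < σ m) (hd0 : 0 < d) (hd2 : d < 1 / 2) (j : ℕ) :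
    Summable fun l : ℕ => a l * σ (l - j) := by
  refine Summable.of_norm_bounded (summable_autocov_shift_div hσ hpos hd2 j) fun l => ?_
  have hl0 : (0 : ℝ) ≤ l := l.cast_nonneg
  rw [norm_eq_abs, abs_mul, abs_of_pos (hpos _)]
  refine mul_le_mul_of_nonneg_right ((abs_coeff_le ha0 ha hd0 hd2 l).trans ?_) (hpos _).le
  exact mul_le_of_le_one_right (div_nonneg (by norm_num) (by linarith))
    (fracWeight_le_one hd0 (by linarith) l)

/-- The Yule–Walker equations of infinite order. -/
lemma tsum_coeff_mul_autocov (ha0 : a 0 = 1)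
    (ha : ∀ l : ℕ, a (l + 1) * (l + 1) = a l * (l - d))
    (hσ : ∀ m : ℤ, σ (m + 1) * (m + 1 - d) = σ m * (m + d))
    (hσ0 : σ 0 = σε2 * Gamma (1 - 2 * d) / Gamma (1 - d) ^ 2)
    (hpos : ∀ m, 0 < σ m) (hd0 : 0 < d) (hd2 : d < 1 / 2) (j : ℕ) :
    ∑' l : ℕ, a l * σ (l - j) = if j = 0 then σε2 else 0 := by
  have hd1 : d < 1 := by linarith
  set f : ℕ → ℕ → ℝ := fun k l =>
    if l ∈ Finset.range (k + 1) then predFilter d a k l * σ (l - j) else 0 with hf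
  have hlim : Tendsto (fun k => ∑' l, f k l) atTop (nhds (∑' l : ℕ, a l * σ (l - j))) := by
    refine tendsto_tsum_of_dominated_convergence (summable_autocov_shift_div hσ hpos hd2 j)
      (fun l => ?_) (Eventually.of_forall fun k l => ?_)
    · rw [← tendsto_add_atTop_iff_nat l]
      have h := ((tendsto_fracWeight_div hd1 l).const_mul (a l)).mul_const (σ (l - j))
      rw [mul_one] at h
      refine h.congr fun n => ?_
      simp only [hf]
      rw [if_pos (Finset.mem_range.2 (by omega)), predFilter, Nat.add_sub_cancel]
    · have hl0 : (0 : ℝ) ≤ l := l.cast_nonneg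
      have hc : 0 ≤ 2 / ((l : ℝ) + 1 - d) := div_nonneg (by norm_num) (by linarith)
      simp only [hf]
      split_ifs with hl
      · rw [norm_eq_abs, abs_mul, abs_of_pos (hpos _)]
        refine mul_le_mul_of_nonneg_right ?_ (hpos _).le
        have hg := fracWeight_pos hd1
        have hle := fracWeight_mul_le hd0 hd1 (k - l) l
        rw [Nat.sub_add_cancel (Nat.lt_succ_iff.1 (Finset.mem_range.1 hl))] at hle
        rw [predFilter, abs_mul, abs_of_pos (div_pos (hg _) (hg _)), mul_div_assoc',
          div_le_iff₀ (hg _)]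
        calc |a l| * fracWeight d (k - l)
            ≤ 2 / (l + 1 - d) * fracWeight d l * fracWeight d (k - l) :=
              mul_le_mul_of_nonneg_right (abs_coeff_le ha0 ha hd0 hd2 l) (hg _).le
          _ = 2 / (l + 1 - d) * (fracWeight d (k - l) * fracWeight d l) := by ring
          _ ≤ _ := mul_le_mul_of_nonneg_left hle hc
      · rw [norm_zero]
        exact mul_nonneg hc (hpos _).le
  have hval : ∀ k, j ≤ k → ∑' l, f k l = if j = 0 then σε2 * predError d k else 0 := by
    intro k hk
    rw [← sum_predFilter ha0 ha hσ hσ0 hd0 hd2 k j hk,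
      tsum_eq_sum (s := Finset.range (k + 1)) fun l hl => if_neg hl]
    exact Finset.sum_congr rfl fun l hl => if_pos hl
  refine tendsto_nhds_unique
    (hlim.congr' (f₂ := fun k => if j = 0 then σε2 * predError d k else 0) ?_) ?_
  · filter_upwards [eventually_ge_atTop j] with k hk using hval k hk
  · split_ifs
    · simpa using (tendsto_predError hd0 hd2).const_mul σε2
    · exact tendsto_const_nhds

/-- The mean-squared error of the truncated Wiener–Kolmogorov predictor. -/
lemma tsum_tsum_tail (ha0 : a 0 = 1)
    (ha : ∀ l : ℕ, a (l + 1) * (l + 1) = a l * (l - d))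
    (hσ : ∀ m : ℤ, σ (m + 1) * (m + 1 - d) = σ m * (m + d))
    (hσ0 : σ 0 = σε2 * Gamma (1 - 2 * d) / Gamma (1 - d) ^ 2)
    (hpos : ∀ m, 0 < σ m) (heven : ∀ m, σ (-m) = σ m)
    (hd0 : 0 < d) (hd2 : d < 1 / 2) (k : ℕ) :
    σε2 + ∑' j : ℕ, ∑' l : ℕ, a (k + 1 + j) * a (k + 1 + l) * σ ((l : ℤ) - j) =
      ∑ j ∈ Finset.range (k + 1), ∑ l ∈ Finset.range (k + 1), a j * a l * σ (l - j) := by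
  have hsum := summable_coeff_mul_autocov ha0 ha hσ hpos hd0 hd2
  have htail : ∀ j : ℕ, ∑' l : ℕ, a (k + 1 + l) * σ ((k + 1 + l : ℕ) - j) =
      (if j = 0 then σε2 else 0) - ∑ l ∈ Finset.range (k + 1), a l * σ (l - j) := by
    intro j
    rw [← tsum_coeff_mul_autocov ha0 ha hσ hσ0 hpos hd0 hd2 j,
      ← (hsum j).sum_add_tsum_nat_add (k + 1), add_sub_cancel_left]
    exact tsum_congr fun l => by rw [add_comm (k + 1) l]
  have hinner : ∀ j : ℕ, ∑' l : ℕ, a (k + 1 + j) * a (k + 1 + l) * σ ((l : ℤ) - j) =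
      ∑ l ∈ Finset.range (k + 1), -a l * (a (k + 1 + j) * σ ((k + 1 + j : ℕ) - l)) := by
    intro j
    have h := htail (k + 1 + j)
    rw [if_neg (by omega), zero_sub] at h
    calc _ = a (k + 1 + j) *
          ∑' l : ℕ, a (k + 1 + l) * σ ((k + 1 + l : ℕ) - (k + 1 + j : ℕ)) := by
          rw [← tsum_mul_left]
          refine tsum_congr fun l => ?_
          rw [show ((k + 1 + l : ℕ) : ℤ) - (k + 1 + j : ℕ) = l - j by push_cast; ring, mul_assoc]
      _ = _ := by
          rw [h, ← Finset.sum_neg_distrib, Finset.mul_sum]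
          refine Finset.sum_congr rfl fun l _ => ?_
          rw [← heven (l - _), neg_sub]
          ring
  have hsum' : ∀ j : ℕ, Summable fun l : ℕ => a (k + 1 + l) * σ ((k + 1 + l : ℕ) - j) := by
    intro j
    refine ((summable_nat_add_iff (k + 1)).2 (hsum j)).congr fun l => ?_
    rw [add_comm l]
  simp only [hinner]
  rw [Summable.tsum_finsetSum fun l _ => (hsum' l).mul_left _]
  simp only [tsum_mul_left, htail, mul_sub, Finset.sum_sub_distrib]
  rw [Finset.sum_eq_single_of_mem 0 (by simp) fun l _ hl => by rw [if_neg hl, mul_zero]]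
  simp only [if_true, ha0, Finset.mul_sum, ← Finset.sum_neg_distrib, sub_eq_add_neg, neg_mul,
    neg_neg, one_mul, add_neg_cancel_left, mul_assoc]

lemma predError_le_quadratic (ha0 : a 0 = 1)
    (ha : ∀ l : ℕ, a (l + 1) * (l + 1) = a l * (l - d))
    (hσ : ∀ m : ℤ, σ (m + 1) * (m + 1 - d) = σ m * (m + d))
    (hσ0 : σ 0 = σε2 * Gamma (1 - 2 * d) / Gamma (1 - d) ^ 2)
    (heven : ∀ m, σ (-m) = σ m)
    (hd0 : 0 < d) (hd2 : d < 1 / 2) (k : ℕ)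
    (hpd : (Matrix.of fun i j : Fin (k + 1) => σ ((i : ℤ) - (j : ℤ))).PosSemidef)
    (c : ℕ → ℝ) (hc0 : c 0 = 1) :
    σε2 * predError d k ≤
      ∑ j ∈ Finset.range (k + 1), ∑ l ∈ Finset.range (k + 1), c j * c l * σ (l - j) := by
  set b := predFilter d a k with hb
  have hb0 : b 0 = 1 := predFilter_zero ha0 (by linarith) k
  have hcross : ∀ u : ℕ → ℝ,
      ∑ j ∈ Finset.range (k + 1), ∑ l ∈ Finset.range (k + 1), u j * b l * σ (l - j) =
        u 0 * (σε2 * predError d k) := by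
    intro u
    rw [Finset.sum_eq_single_of_mem 0 (by simp)]
    · simp only [mul_assoc, ← Finset.mul_sum]
      rw [sum_predFilter ha0 ha hσ hσ0 hd0 hd2 k 0 (by omega), if_pos rfl]
    · intro j hj hj0
      simp only [mul_assoc, ← Finset.mul_sum]
      rw [sum_predFilter ha0 ha hσ hσ0 hd0 hd2 k j (by simpa [Nat.lt_succ_iff] using hj),
        if_neg hj0, mul_zero]
  have hcross' : ∑ j ∈ Finset.range (k + 1), ∑ l ∈ Finset.range (k + 1),
      b j * c l * σ (l - j) = σε2 * predError d k := by
    rw [Finset.sum_comm, ← one_mul (σε2 * _), ← hc0, ← hcross c]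
    refine Finset.sum_congr rfl fun j _ => Finset.sum_congr rfl fun l _ => ?_
    rw [← heven (j - l), neg_sub]
    ring
  have hnn : 0 ≤ ∑ j ∈ Finset.range (k + 1), ∑ l ∈ Finset.range (k + 1),
      (c j - b j) * (c l - b l) * σ (l - j) := by
    have h := hpd.dotProduct_mulVec_nonneg fun i : Fin (k + 1) => c i - b i
    simp only [dotProduct, mulVec, Matrix.of_apply, star_trivial, Finset.mul_sum] at h
    rw [Finset.sum_range]
    simp only [Finset.sum_range]
    refine h.trans_eq (Finset.sum_congr rfl fun j _ => Finset.sum_congr rfl fun l _ => ?_)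
    rw [← heven (l - j), neg_sub]
    ring
  have hexp : ∑ j ∈ Finset.range (k + 1), ∑ l ∈ Finset.range (k + 1),
      (c j - b j) * (c l - b l) * σ (l - j) =
      ∑ j ∈ Finset.range (k + 1), ∑ l ∈ Finset.range (k + 1), c j * c l * σ (l - j)
      - ∑ j ∈ Finset.range (k + 1), ∑ l ∈ Finset.range (k + 1), c j * b l * σ (l - j)
      - ∑ j ∈ Finset.range (k + 1), ∑ l ∈ Finset.range (k + 1), b j * c l * σ (l - j)
      + ∑ j ∈ Finset.range (k + 1), ∑ l ∈ Finset.range (k + 1), b j * b l * σ (l - j) := by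
    simp only [← Finset.sum_sub_distrib, ← Finset.sum_add_distrib]
    refine Finset.sum_congr rfl fun j _ => Finset.sum_congr rfl fun l _ => ?_
    ring
  rw [hexp, hcross, hcross, hcross', hc0, hb0] at hnn
  linarith

lemma schur_complement_eq_predError (ha0 : a 0 = 1)
    (ha : ∀ l : ℕ, a (l + 1) * (l + 1) = a l * (l - d))
    (hσ : ∀ m : ℤ, σ (m + 1) * (m + 1 - d) = σ m * (m + d))
    (hσ0 : σ 0 = σε2 * Gamma (1 - 2 * d) / Gamma (1 - d) ^ 2)
    (heven : ∀ m, σ (-m) = σ m)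
    (hd0 : 0 < d) (hd2 : d < 1 / 2) (k : ℕ)
    (hpd : (Matrix.of fun i j : Fin k => σ ((i : ℤ) - (j : ℤ))).PosDef) :
    σ 0 - (fun i : Fin k => σ ((i : ℤ) + 1)) ⬝ᵥ
        ((Matrix.of fun i j : Fin k => σ ((i : ℤ) - (j : ℤ)))⁻¹ *ᵥ
          fun i : Fin k => σ ((i : ℤ) + 1)) = σε2 * predError d k := by
  set M := Matrix.of fun i j : Fin k => σ ((i : ℤ) - (j : ℤ)) with hM
  set x : Fin k → ℝ := fun i => -predFilter d a k (i + 1) with hx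
  have hYW := sum_predFilter ha0 ha hσ hσ0 hd0 hd2 k
  simp only [Finset.sum_range_succ' _ k, predFilter_zero ha0 (by linarith : d < 1) k,
    Finset.sum_range] at hYW
  have hMx : M *ᵥ x = fun i : Fin k => σ ((i : ℤ) + 1) := by
    ext i
    have h := hYW (i + 1) (by omega)
    rw [if_neg (by omega), ← heven] at h
    simp only [mulVec, dotProduct, hM, hx, Matrix.of_apply, mul_neg, Finset.sum_neg_distrib]
    rw [neg_eq_iff_add_eq_zero, ← h]
    push_cast
    rw [one_mul, zero_sub, neg_neg]
    congr 1
    refine Finset.sum_congr rfl fun l _ => ?_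
    rw [mul_comm, ← heven, show -((i : ℤ) - l) = l + 1 - (i + 1) by ring]
  have hinv : M⁻¹ *ᵥ (fun i : Fin k => σ ((i : ℤ) + 1)) = x := by
    rw [← hMx, mulVec_mulVec, nonsing_inv_mul _ ((isUnit_iff_isUnit_det _).1 hpd.isUnit), one_mulVec]
  have h := hYW 0 (by omega)
  rw [if_pos rfl] at h
  rw [hinv, ← h]
  simp only [dotProduct, hx, mul_neg, Finset.sum_neg_distrib]
  push_cast
  rw [sub_neg_eq_add, one_mul, add_comm]
  congr 1
  refine Finset.sum_congr rfl fun l _ => ?_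
  rw [mul_comm, sub_zero]

end Prediction

lemma coeff_recurrence {d : ℝ} (hd0 : 0 < d) (hd1 : d < 1) {a : ℕ → ℝ} (ha0 : a 0 = 1)
    (ha : ∀ j : ℕ, 1 ≤ j →
      a j = Gamma ((j : ℝ) - d) / (Gamma ((j : ℝ) + 1) * Gamma (-d))) (l : ℕ) :
    a (l + 1) * (l + 1) = a l * (l - d) := by
  have hG : Gamma (1 - d) = -d * Gamma (-d) := by
    rw [← Gamma_add_one (by linarith)]
    congr 1
    ring
  have h0 : Gamma (-d) ≠ 0 := by
    intro h
    rw [h, mul_zero] at hG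
    exact (Gamma_pos_of_pos (by linarith : 0 < 1 - d)).ne' hG
  have hal : a l = Gamma ((l : ℝ) - d) / (Gamma ((l : ℝ) + 1) * Gamma (-d)) := by
    rcases l with _ | l
    · simp [ha0, h0]
    · exact ha _ (by omega)
  have hl : (0 : ℝ) ≤ l := l.cast_nonneg
  have e1 : Gamma ((l + 1 : ℕ) - d) = (l - d) * Gamma (l - d) := by
    rw [← Gamma_add_one (natCast_sub_ne_zero hd0 hd1 l)]
    congr 1
    push_cast
    ring
  have e2 : Gamma ((l + 1 : ℕ) + 1) = (l + 1) * Gamma (l + 1) := by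
    rw [← Gamma_add_one (by linarith)]
    push_cast
    rfl
  have h2 : Gamma ((l : ℝ) + 1) ≠ 0 := (Gamma_pos_of_pos (by linarith)).ne'
  rw [hal, ha _ (by omega), e1, e2]
  field_simp

lemma autocov_recurrence {d C : ℝ} (hd0 : 0 < d) (hd1 : d < 1) {σ : ℤ → ℝ}
    (hσ : ∀ m : ℤ, σ m = C * Gamma ((|m| : ℤ) + d) /
      (Gamma d * Gamma (1 - d) * Gamma ((|m| : ℤ) + 1 - d))) (m : ℤ) :
    σ (m + 1) * (m + 1 - d) = σ m * (m + d) := by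
  have hnat : ∀ n : ℕ, σ (n + 1) * (n + 1 - d) = σ n * (n + d) := by
    intro n
    have hn : (0 : ℝ) ≤ n := n.cast_nonneg
    have e1 : Gamma ((n : ℝ) + 1 + d) = (n + d) * Gamma (n + d) := by
      rw [← Gamma_add_one (by linarith)]
      congr 1
      ring
    have e2 : Gamma ((n : ℝ) + 1 + 1 - d) = (n + 1 - d) * Gamma (n + 1 - d) := by
      rw [← Gamma_add_one (by linarith)]
      congr 1
      ring
    have h1 : Gamma (1 - d) ≠ 0 := (Gamma_pos_of_pos (by linarith)).ne'
    have h2 : Gamma d ≠ 0 := (Gamma_pos_of_pos hd0).ne'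
    have h3 : Gamma ((n : ℝ) + 1 - d) ≠ 0 := (Gamma_pos_of_pos (by linarith)).ne'
    have h4 : (n : ℝ) + 1 - d ≠ 0 := by linarith
    rw [hσ, hσ, abs_of_nonneg (by positivity), abs_of_nonneg (by positivity)]
    push_cast
    rw [e1, e2]
    field_simp
  have heven : ∀ m, σ (-m) = σ m := fun m => by rw [hσ, hσ, abs_neg]
  rcases lt_or_ge m 0 with hm | hm
  · obtain ⟨n, hn⟩ := Int.eq_ofNat_of_zero_le (show 0 ≤ -m - 1 by omega)
    obtain rfl : m = -((n : ℤ) + 1) := by omega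
    have h := hnat n
    rw [show -((n : ℤ) + 1) + 1 = -n by ring, heven, heven]
    push_cast
    linear_combination h
  · lift m to ℕ using hm
    exact_mod_cast hnat m

/-- For F(d), `0 < d < 1/2`, with autocovariance `σ` and AR coefficients `a`,
if the Toeplitz matrices `Σ_k = (σ(i-j))` are positive definite, then the k-th order best
linear one-step prediction error `σ(0) - vₖᵀ Σₖ⁻¹ vₖ` (with `vₖ = (σ(1),…,σ(k))ᵀ`) lies
between `σε²` and `σε² + ∑_{j,l>k} a_j a_l σ(l-j)`; consequently its excess over `σε²`
is `O(k⁻¹)`. -/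
theorem stmt_15 (d σε2 : ℝ) (hd0 : 0 < d) (hd2 : d < 1 / 2) (hσε2 : 0 < σε2)
    (a : ℕ → ℝ) (σ : ℤ → ℝ) (ha0 : a 0 = 1)
    (ha : ∀ j : ℕ, 1 ≤ j →
      a j = Real.Gamma ((j : ℝ) - d) / (Real.Gamma ((j : ℝ) + 1) * Real.Gamma (-d)))
    (hσ : ∀ m : ℤ, σ m = σε2 * Real.Gamma (1 - 2 * d) * Real.Gamma ((|m| : ℤ) + d) /
      (Real.Gamma d * Real.Gamma (1 - d) * Real.Gamma ((|m| : ℤ) + 1 - d)))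
    (hpd : ∀ k : ℕ, 1 ≤ k →
      (Matrix.of fun i j : Fin k => σ ((i : ℤ) - (j : ℤ))).PosDef) :
    (∀ k : ℕ, 1 ≤ k →
      σε2 ≤ σ 0 - (fun i : Fin k => σ ((i : ℤ) + 1)) ⬝ᵥ
          ((Matrix.of fun i j : Fin k => σ ((i : ℤ) - (j : ℤ)))⁻¹ *ᵥ
            fun i : Fin k => σ ((i : ℤ) + 1)) ∧
      σ 0 - (fun i : Fin k => σ ((i : ℤ) + 1)) ⬝ᵥ
          ((Matrix.of fun i j : Fin k => σ ((i : ℤ) - (j : ℤ)))⁻¹ *ᵥ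
            fun i : Fin k => σ ((i : ℤ) + 1))
        ≤ σε2 + ∑' j : ℕ, ∑' l : ℕ, a (k + 1 + j) * a (k + 1 + l) * σ ((l : ℤ) - j)) ∧
    (fun k : ℕ => σ 0 - (fun i : Fin k => σ ((i : ℤ) + 1)) ⬝ᵥ
        ((Matrix.of fun i j : Fin k => σ ((i : ℤ) - (j : ℤ)))⁻¹ *ᵥ
          fun i : Fin k => σ ((i : ℤ) + 1)) - σε2)
      =O[atTop] fun k : ℕ => (k : ℝ)⁻¹ := by
  have hd1 : d < 1 := by linarith
  have hrec := coeff_recurrence hd0 hd1 ha0 ha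
  have hσrec := autocov_recurrence hd0 hd1 hσ
  have heven : ∀ m, σ (-m) = σ m := fun m => by rw [hσ, hσ, abs_neg]
  have hG1 : 0 < Gamma (1 - 2 * d) := Gamma_pos_of_pos (by linarith)
  have hG2 : 0 < Gamma d := Gamma_pos_of_pos hd0
  have hG3 : 0 < Gamma (1 - d) := Gamma_pos_of_pos (by linarith)
  have hpos : ∀ m, 0 < σ m := by
    intro m
    have hm : (0 : ℝ) ≤ (|m| : ℤ) := by exact_mod_cast abs_nonneg m
    have h1 : 0 < Gamma ((|m| : ℤ) + d) := Gamma_pos_of_pos (by linarith)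
    have h2 : 0 < Gamma ((|m| : ℤ) + 1 - d) := Gamma_pos_of_pos (by linarith)
    rw [hσ]
    positivity
  have hσ0 : σ 0 = σε2 * Gamma (1 - 2 * d) / Gamma (1 - d) ^ 2 := by
    rw [hσ, abs_zero, Int.cast_zero, zero_add, zero_add]
    field_simp
  have hval := fun k (hk : 1 ≤ k) =>
    schur_complement_eq_predError ha0 hrec hσrec hσ0 heven hd0 hd2 k (hpd k hk)
  refine ⟨fun k hk => ?_, ?_⟩
  · rw [hval k hk, tsum_tsum_tail ha0 hrec hσrec hσ0 hpos heven hd0 hd2 k]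
    exact ⟨le_mul_of_one_le_right hσε2.le (one_le_predError hd2 k),
      predError_le_quadratic ha0 hrec hσrec hσ0 heven hd0 hd2 k
        (hpd (k + 1) (by omega)).posSemidef a ha0⟩
  · refine IsBigO.of_bound σε2 ?_
    filter_upwards [eventually_ge_atTop 1] with k hk
    have hk' : (1 : ℝ) ≤ k := by exact_mod_cast hk
    have h1 := one_le_predError hd2 k
    have h2 := predError_le hd0 hd2 hk
    have h3 : d / (k - d) ≤ (k : ℝ)⁻¹ := by
      rw [← one_div, div_le_div_iff₀ (by linarith) (by linarith)]
      nlinarith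
    rw [hval k hk, norm_eq_abs, norm_of_nonneg (by positivity),
      show σε2 * predError d k - σε2 = σε2 * (predError d k - 1) by ring,
      abs_of_nonneg (mul_nonneg hσε2.le (by linarith))]
    exact mul_le_mul_of_nonneg_left (by linarith) hσε2.le
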